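/- Let u, q : ℝ × ℝ → ℝ be smooth functions, 2π-periodic in the first (spatial) variable, satisfying ∂ₜu = ∂ₓₓu + ∂ₓ(u·q) and ∂ₜq = u·∂ₓu. Then for every t ∈ ℝ the function t ↦ (1/2)∫₀^{2π} ((∂ₓₓu(x,t))² + (∂ₓₓq(x,t))²) dx has derivative at t equal to −∫₀^{2π} (∂ₓₓₓu(x,t))² dx + (5/2)∫₀^{2π} ∂ₓq(x,t)·(∂ₓₓu(x,t))² dx + 5∫₀^{2π} ∂ₓₓq(x,t)·∂ₓₓu(x,t)·∂ₓu(x,t) dx. -/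

import Mathlib

open intervalIntegral Real

/-- Partial derivative in the first (spatial) variable of a function on ℝ × ℝ. -/
noncomputable def pdx (f : ℝ × ℝ → ℝ) (p : ℝ × ℝ) : ℝ :=
  deriv (fun y => f (y, p.2)) p.1

/-- Partial derivative in the second (time) variable of a function on ℝ × ℝ. -/
noncomputable def pdt (f : ℝ × ℝ → ℝ) (p : ℝ × ℝ) : ℝ :=
  deriv (fun s => f (p.1, s)) p.2

theorem h2_dx {f : ℝ × ℝ → ℝ} (hf : ContDiff ℝ (⊤ : ℕ∞) f) (p : ℝ × ℝ) :
    HasDerivAt (fun y => f (y, p.2)) (fderiv ℝ f p (1, 0)) p.1 := by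
  have h1 : HasFDerivAt f (fderiv ℝ f p) (p.1, p.2) :=
    (hf.differentiable (by simp) p).hasFDerivAt
  have h2 : HasDerivAt (fun y : ℝ => (y, p.2)) ((1 : ℝ), (0 : ℝ)) p.1 :=
    (hasDerivAt_id p.1).prodMk (hasDerivAt_const _ _)
  exact h1.comp_hasDerivAt p.1 h2

theorem h2_dt {f : ℝ × ℝ → ℝ} (hf : ContDiff ℝ (⊤ : ℕ∞) f) (p : ℝ × ℝ) :
    HasDerivAt (fun s => f (p.1, s)) (fderiv ℝ f p (0, 1)) p.2 := by
  have h1 : HasFDerivAt f (fderiv ℝ f p) (p.1, p.2) :=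
    (hf.differentiable (by simp) p).hasFDerivAt
  have h2 : HasDerivAt (fun y : ℝ => (p.1, y)) ((0 : ℝ), (1 : ℝ)) p.2 :=
    (hasDerivAt_const _ _).prodMk (hasDerivAt_id p.2)
  exact h1.comp_hasDerivAt p.2 h2

theorem h2_pdx_eq {f : ℝ × ℝ → ℝ} (hf : ContDiff ℝ (⊤ : ℕ∞) f) :
    pdx f = fun p => fderiv ℝ f p (1, 0) := funext fun p => (h2_dx hf p).deriv

theorem h2_pdt_eq {f : ℝ × ℝ → ℝ} (hf : ContDiff ℝ (⊤ : ℕ∞) f) :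
    pdt f = fun p => fderiv ℝ f p (0, 1) := funext fun p => (h2_dt hf p).deriv

theorem h2_smooth_ap {f : ℝ × ℝ → ℝ} (hf : ContDiff ℝ (⊤ : ℕ∞) f) (v : ℝ × ℝ) :
    ContDiff ℝ (⊤ : ℕ∞) (fun p => fderiv ℝ f p v) :=
  (hf.fderiv_right (m := (⊤ : ℕ∞)) (by simp)).clm_apply contDiff_const

theorem h2_smooth_x {f : ℝ × ℝ → ℝ} (hf : ContDiff ℝ (⊤ : ℕ∞) f) :
    ContDiff ℝ (⊤ : ℕ∞) (pdx f) := by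
  rw [h2_pdx_eq hf]; exact h2_smooth_ap hf _

theorem h2_smooth_t {f : ℝ × ℝ → ℝ} (hf : ContDiff ℝ (⊤ : ℕ∞) f) :
    ContDiff ℝ (⊤ : ℕ∞) (pdt f) := by
  rw [h2_pdt_eq hf]; exact h2_smooth_ap hf _

theorem h2_hx {f : ℝ × ℝ → ℝ} (hf : ContDiff ℝ (⊤ : ℕ∞) f) (x t : ℝ) :
    HasDerivAt (fun y => f (y, t)) (pdx f (x, t)) x := by
  rw [h2_pdx_eq hf]; exact h2_dx hf (x, t)

theorem h2_ht {f : ℝ × ℝ → ℝ} (hf : ContDiff ℝ (⊤ : ℕ∞) f) (x t : ℝ) :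
    HasDerivAt (fun s => f (x, s)) (pdt f (x, t)) t := by
  rw [h2_pdt_eq hf]; exact h2_dt hf (x, t)

theorem h2_comm {f : ℝ × ℝ → ℝ} (hf : ContDiff ℝ (⊤ : ℕ∞) f) :
    pdt (pdx f) = pdx (pdt f) := by
  have hd : Differentiable ℝ (fderiv ℝ f) :=
    (hf.fderiv_right (m := (⊤ : ℕ∞)) (by simp)).differentiable (by simp)
  rw [h2_pdt_eq (h2_smooth_x hf), h2_pdx_eq (h2_smooth_t hf), h2_pdx_eq hf, h2_pdt_eq hf]
  funext p
  have key : ∀ v w : ℝ × ℝ, fderiv ℝ (fun p => fderiv ℝ f p v) p w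
      = fderiv ℝ (fderiv ℝ f) p w v := by
    intro v w
    rw [fderiv_clm_apply (hd p) (differentiableAt_const v)]
    simp
  rw [key, key]
  exact (hf.contDiffAt (x := p)).isSymmSndFDerivAt (by
    rw [minSmoothness_of_isRCLikeNormedField]; exact WithTop.coe_le_coe.2 (le_top : (2 : ℕ∞) ≤ ⊤)) _ _

theorem h2_add {f g : ℝ × ℝ → ℝ} (hf : ContDiff ℝ (⊤ : ℕ∞) f) (hg : ContDiff ℝ (⊤ : ℕ∞) g) :
    pdx (fun r => f r + g r) = fun r => pdx f r + pdx g r :=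
  funext fun p => ((h2_hx hf p.1 p.2).add (h2_hx hg p.1 p.2)).deriv

theorem h2_mul {f g : ℝ × ℝ → ℝ} (hf : ContDiff ℝ (⊤ : ℕ∞) f) (hg : ContDiff ℝ (⊤ : ℕ∞) g) :
    pdx (fun r => f r * g r) = fun r => pdx f r * g r + f r * pdx g r :=
  funext fun p => ((h2_hx hf p.1 p.2).mul (h2_hx hg p.1 p.2)).deriv

theorem h2_per {f : ℝ × ℝ → ℝ} (h : ∀ x t : ℝ, f (x + 2 * π, t) = f (x, t)) :
    ∀ x t : ℝ, pdx f (x + 2 * π, t) = pdx f (x, t) := by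
  intro x t
  have := deriv_comp_add_const (fun y => f (y, t)) (2 * π) x
  simp only [h] at this
  exact this.symm

theorem h2_leib {G : ℝ × ℝ → ℝ} (hG : ContDiff ℝ (⊤ : ℕ∞) G) (a b t : ℝ) :
    HasDerivAt (fun s => ∫ x in a..b, G (x, s)) (∫ x in a..b, pdt G (x, t)) t := by
  have hc : Continuous (pdt G) := (h2_smooth_t hG).continuous
  obtain ⟨C, hC⟩ := ((isCompact_uIcc (a := a) (b := b)).prod
    (isCompact_Icc (a := t - 1) (b := t + 1))).exists_bound_of_continuousOn hc.continuousOn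
  have hGc : ∀ s, Continuous fun x => G (x, s) := fun s =>
    hG.continuous.comp (by fun_prop)
  refine (intervalIntegral.hasDerivAt_integral_of_dominated_loc_of_deriv_le
    (F := fun s x => G (x, s)) (F' := fun s x => pdt G (x, s)) (bound := fun _ => C)
    (s := Set.Icc (t - 1) (t + 1)) (Icc_mem_nhds (by linarith) (by linarith))
    (Filter.Eventually.of_forall fun s => (hGc s).aestronglyMeasurable)
    ((hGc t).intervalIntegrable _ _)
    (hc.comp (by fun_prop : Continuous fun x : ℝ => (x, t))).aestronglyMeasurable
    (Filter.Eventually.of_forall fun x hx s hs => hC (x, s) ⟨Set.uIoc_subset_uIcc hx, hs⟩)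
    intervalIntegrable_const
    (Filter.Eventually.of_forall fun x hx s hs => h2_ht hG x s)).2

theorem h2_lin {A B C D G : ℝ → ℝ} {a b : ℝ}
    (hA : IntervalIntegrable A MeasureTheory.volume a b)
    (hB : IntervalIntegrable B MeasureTheory.volume a b)
    (hC : IntervalIntegrable C MeasureTheory.volume a b)
    (hD : IntervalIntegrable D MeasureTheory.volume a b)
    (hz : ∫ x in a..b, D x = 0)
    (h : ∀ x, 1 / 2 * G x = (-1) * A x + 5 / 2 * B x + 5 * C x + D x) :
    1 / 2 * (∫ x in a..b, G x) = -(∫ x in a..b, A x) + 5 / 2 * (∫ x in a..b, B x)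
      + 5 * ∫ x in a..b, C x := by
  rw [← integral_const_mul, integral_congr (fun x _ => h x),
    integral_add (((hA.const_mul _).add (hB.const_mul _)).add (hC.const_mul _)) hD,
    integral_add ((hA.const_mul _).add (hB.const_mul _)) (hC.const_mul _),
    integral_add (hA.const_mul _) (hB.const_mul _), integral_const_mul, integral_const_mul,
    integral_const_mul, hz]
  ring

/-- The Ḣ² energy identity for the 1D chemotaxis system with classical diffusion:
(1/2) d/dt ∫((∂ₓₓu)² + (∂ₓₓq)²) dx
  = −∫(∂ₓₓₓu)² dx + (5/2)∫ ∂ₓq (∂ₓₓu)² dx + 5∫ ∂ₓₓq ∂ₓₓu ∂ₓu dx. -/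
theorem energy_identity_H2
    (u q : ℝ × ℝ → ℝ) (hu : ContDiff ℝ (⊤ : ℕ∞) u) (hq : ContDiff ℝ (⊤ : ℕ∞) q)
    (hu_per : ∀ x t : ℝ, u (x + 2 * π, t) = u (x, t))
    (hq_per : ∀ x t : ℝ, q (x + 2 * π, t) = q (x, t))
    (heq_u : ∀ p : ℝ × ℝ, pdt u p = pdx (pdx u) p + pdx (fun r => u r * q r) p)
    (heq_q : ∀ p : ℝ × ℝ, pdt q p = u p * pdx u p) :
    ∀ t : ℝ,
      HasDerivAt
        (fun s => (1 / 2 : ℝ) *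
          ∫ x in (0:ℝ)..(2 * π), ((pdx (pdx u) (x, s)) ^ 2 + (pdx (pdx q) (x, s)) ^ 2))
        (-(∫ x in (0:ℝ)..(2 * π), (pdx (pdx (pdx u)) (x, t)) ^ 2)
          + (5 / 2 : ℝ) * (∫ x in (0:ℝ)..(2 * π), pdx q (x, t) * (pdx (pdx u) (x, t)) ^ 2)
          + 5 * ∫ x in (0:ℝ)..(2 * π),
              pdx (pdx q) (x, t) * pdx (pdx u) (x, t) * pdx u (x, t)) t := by
  intro t
  have hu1 := h2_smooth_x hu
  have hu2 := h2_smooth_x hu1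
  have hu3 := h2_smooth_x hu2
  have hu4 := h2_smooth_x hu3
  have hq1 := h2_smooth_x hq
  have hq2 := h2_smooth_x hq1
  have hq3 := h2_smooth_x hq2
  have eu : pdt (pdx (pdx u)) = fun r => pdx (pdx (pdx (pdx u))) r
      + (pdx (pdx (pdx u)) r * q r + 3 * (pdx (pdx u) r * pdx q r)
        + 3 * (pdx u r * pdx (pdx q) r) + u r * pdx (pdx (pdx q)) r) := by
    rw [h2_comm hu1, h2_comm hu, funext heq_u, h2_mul hu hq,
      h2_add hu2 ((hu1.mul hq).add (hu.mul hq1)), h2_add (hu1.mul hq) (hu.mul hq1),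
      h2_mul hu1 hq, h2_mul hu hq1,
      h2_add hu3 (((hu2.mul hq).add (hu1.mul hq1)).add ((hu1.mul hq1).add (hu.mul hq2))),
      h2_add ((hu2.mul hq).add (hu1.mul hq1)) ((hu1.mul hq1).add (hu.mul hq2)),
      h2_add (hu2.mul hq) (hu1.mul hq1), h2_add (hu1.mul hq1) (hu.mul hq2),
      h2_mul hu2 hq, h2_mul hu1 hq1, h2_mul hu hq2]
    funext r
    ring
  have eq : pdt (pdx (pdx q)) = fun r => u r * pdx (pdx (pdx u)) r
      + 3 * (pdx u r * pdx (pdx u) r) := by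
    rw [h2_comm hq1, h2_comm hq, funext heq_q, h2_mul hu hu1,
      h2_add (hu1.mul hu1) (hu.mul hu2), h2_mul hu1 hu1, h2_mul hu hu2]
    funext r
    ring
  have hG : ContDiff ℝ (⊤ : ℕ∞) (fun r => (pdx (pdx u) r) ^ 2 + (pdx (pdx q) r) ^ 2) :=
    (hu2.pow 2).add (hq2.pow 2)
  have hL := (h2_leib hG 0 (2 * π) t).const_mul (1 / 2 : ℝ)
  refine hL.congr_deriv ?_
  -- the exact x-derivative
  have hF : ContDiff ℝ (⊤ : ℕ∞) (fun r => pdx (pdx u) r * pdx (pdx (pdx u)) r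
      + (1 / 2 : ℝ) * (q r * (pdx (pdx u) r * pdx (pdx u) r))
      + u r * (pdx (pdx u) r * pdx (pdx q) r)) :=
    ((hu2.mul hu3).add (contDiff_const.mul (hq.mul (hu2.mul hu2)))).add (hu.mul (hu2.mul hq2))
  have cont : ∀ {f : ℝ × ℝ → ℝ}, ContDiff ℝ (⊤ : ℕ∞) f → IntervalIntegrable
      (fun x => f (x, t)) MeasureTheory.volume 0 (2 * π) := fun hf =>
    (hf.continuous.comp (by fun_prop : Continuous fun x : ℝ => (x, t))).intervalIntegrable _ _
  have hz := integral_eq_sub_of_hasDerivAt (fun x _ => h2_hx hF x t) (cont (h2_smooth_x hF))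
  have pu2 := h2_per (h2_per hu_per)
  have pu3 := h2_per pu2
  have pq2 := h2_per (h2_per hq_per)
  have e1 := hu_per 0 t
  have e2 := hq_per 0 t
  have e3 := pu2 0 t
  have e4 := pu3 0 t
  have e5 := pq2 0 t
  simp only [zero_add] at e1 e2 e3 e4 e5
  rw [e1, e2, e3, e4, e5, sub_self] at hz
  have i1 := cont (hu3.pow 2)
  have i2 := cont (hq1.mul (hu2.pow 2))
  have i3 := cont ((hq2.mul hu2).mul hu1)
  have i4 := cont (h2_smooth_x hF)
  refine h2_lin i1 i2 i3 i4 hz fun x => ?_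
  have d1 : pdt (fun r => (pdx (pdx u) r) ^ 2 + (pdx (pdx q) r) ^ 2) (x, t) = _ :=
    (((h2_ht hu2 x t).pow 2).add ((h2_ht hq2 x t).pow 2)).deriv
  have d2 : pdx (fun r => pdx (pdx u) r * pdx (pdx (pdx u)) r
      + (1 / 2 : ℝ) * (q r * (pdx (pdx u) r * pdx (pdx u) r))
      + u r * (pdx (pdx u) r * pdx (pdx q) r)) (x, t) = _ :=
    ((((h2_hx hu2 x t).mul (h2_hx hu3 x t)).add (((h2_hx hq x t).mul
      ((h2_hx hu2 x t).mul (h2_hx hu2 x t))).const_mul (1 / 2 : ℝ))).add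
      ((h2_hx hu x t).mul ((h2_hx hu2 x t).mul (h2_hx hq2 x t)))).deriv
  simp only [d1, d2, eu, eq]
  simp
  ring
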